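/- As r → 0⁺, the CDF F(r) = 1 - 2√r·K₁(2√r) satisfies F(r) = r·(1 - 2γ_E - log r) + o(r log(1/r)); in particular F(r)/(r·log(1/r)) → 1 as r → 0⁺. -/

import Mathlib

open MeasureTheory ProbabilityTheory Real Set Filter Topology Asymptotics

/-- Modified Bessel function of the second kind of order 1, via the integral
representation `K₁(x) = ∫₀^∞ exp (-x * cosh t) * cosh t dt`. -/
noncomputable def besselK1 (x : ℝ) : ℝ :=
  ∫ t in Set.Ioi (0 : ℝ), Real.exp (-x * Real.cosh t) * Real.cosh t

/-- The substitution `u = x cosh t` gives `∫₀^∞ x e^{-x cosh t} sinh t dt = e^{-x}`. -/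
theorem integral_exp_neg_mul_cosh_mul_sinh {x : ℝ} (hx : 0 < x) :
    IntegrableOn (fun t => x * (Real.exp (-x * Real.cosh t) * Real.sinh t)) (Ioi 0) ∧
    ∫ t in Ioi (0 : ℝ), x * (Real.exp (-x * Real.cosh t) * Real.sinh t) = Real.exp (-x) := by
  have hderiv : ∀ t ∈ Ici (0 : ℝ), HasDerivAt (fun t => -Real.exp (-x * Real.cosh t))
      (x * (Real.exp (-x * Real.cosh t) * Real.sinh t)) t := by
    intro t _
    exact (((Real.hasDerivAt_cosh t).const_mul (-x)).exp).neg.congr_deriv (by ring)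
  have hpos : ∀ t ∈ Ioi (0 : ℝ), 0 ≤ x * (Real.exp (-x * Real.cosh t) * Real.sinh t) := by
    intro t ht
    have := Real.sinh_nonneg_iff.mpr (le_of_lt ht)
    positivity
  have hcosh : Tendsto Real.cosh atTop atTop := by
    refine tendsto_atTop_mono (fun t => ?_)
      (Real.tendsto_exp_atTop.atTop_div_const (show (0 : ℝ) < 2 by norm_num))
    rw [Real.cosh_eq]
    have := Real.exp_pos (-t)
    linarith
  have hlim : Tendsto (fun t => -Real.exp (-x * Real.cosh t)) atTop (𝓝 0) := by
    have h : Tendsto (fun t => -x * Real.cosh t) atTop atBot :=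
      hcosh.const_mul_atTop_of_neg (neg_lt_zero.mpr hx)
    simpa using (Real.tendsto_exp_atBot.comp h).neg
  refine ⟨integrableOn_Ioi_deriv_of_nonneg' hderiv hpos hlim, ?_⟩
  rw [integral_Ioi_of_hasDerivAt_of_nonneg' hderiv hpos hlim]
  simp

theorem integrableOn_exp_neg_mul_cosh_mul_exp_neg {x : ℝ} (hx : 0 < x) :
    IntegrableOn (fun t => Real.exp (-x * Real.cosh t) * Real.exp (-t)) (Ioi 0) := by
  refine Integrable.mono' (integrableOn_exp_neg_Ioi 0)
    (Continuous.aestronglyMeasurable (by fun_prop)) (.of_forall fun t => ?_)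
  rw [Real.norm_of_nonneg (by positivity)]
  have h : Real.exp (-x * Real.cosh t) ≤ 1 :=
    Real.exp_le_one_iff.mpr (by nlinarith [Real.cosh_pos t])
  exact mul_le_of_le_one_left (Real.exp_pos _).le h

theorem integrableOn_one_sub_exp_mul_exp_neg {x : ℝ} (hx : 0 < x) :
    IntegrableOn (fun t => (1 - Real.exp (-x * Real.cosh t)) * Real.exp (-t)) (Ioi 0) := by
  simp only [sub_mul, one_mul]
  exact (integrableOn_exp_neg_Ioi 0).sub (integrableOn_exp_neg_mul_cosh_mul_exp_neg hx)

theorem one_sub_mul_besselK1 {x : ℝ} (hx : 0 < x) :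
    1 - x * besselK1 x = 1 - Real.exp (-x) - x +
      x * ∫ t in Ioi (0 : ℝ), (1 - Real.exp (-x * Real.cosh t)) * Real.exp (-t) := by
  obtain ⟨hi, he⟩ := integral_exp_neg_mul_cosh_mul_sinh hx
  have hj := integrableOn_exp_neg_mul_cosh_mul_exp_neg hx
  have h1 : x * besselK1 x = Real.exp (-x) +
      x * ∫ t in Ioi (0 : ℝ), Real.exp (-x * Real.cosh t) * Real.exp (-t) := by
    rw [← he, besselK1, ← integral_const_mul, ← integral_const_mul,
      ← integral_add hi (hj.const_mul x)]
    refine integral_congr_ae (.of_forall fun t => ?_)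
    simp only [← Real.cosh_sub_sinh]
    ring
  have h2 : ∫ t in Ioi (0 : ℝ), (1 - Real.exp (-x * Real.cosh t)) * Real.exp (-t) =
      1 - ∫ t in Ioi (0 : ℝ), Real.exp (-x * Real.cosh t) * Real.exp (-t) := by
    simp only [sub_mul, one_mul]
    rw [integral_sub (integrableOn_exp_neg_Ioi 0) hj, integral_exp_neg_Ioi_zero]
  rw [h1, h2]
  ring

theorem abs_integral_one_sub_exp_mul_exp_neg_sub_le {x : ℝ} (hx : 0 < x) (hx1 : x < 1) :
    |(∫ t in Ioi (0 : ℝ), (1 - Real.exp (-x * Real.cosh t)) * Real.exp (-t)) -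
      x / 2 * Real.log (1 / x)| ≤ 2 * x := by
  set h : ℝ → ℝ := fun t => (1 - Real.exp (-x * Real.cosh t)) * Real.exp (-t)
  set T := Real.log (1 / x) with hT
  have hT0 : 0 < T := Real.log_pos ((one_lt_div hx).mpr hx1)
  have hexpT : Real.exp T = 1 / x := Real.exp_log (by positivity)
  have hexpT' : Real.exp (-T) = x := by rw [Real.exp_neg, hexpT]; simp
  have hint := integrableOn_one_sub_exp_mul_exp_neg hx
  have hcont : Continuous h := by fun_prop
  have hsplit : ∫ t in Ioi (0 : ℝ), h t = (∫ t in (0 : ℝ)..T, h t) + ∫ t in Ioi T, h t :=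
    (intervalIntegral.integral_interval_add_Ioi hint (hint.mono_set (Ioi_subset_Ioi hT0.le))).symm
  have htail0 : 0 ≤ ∫ t in Ioi T, h t := by
    refine integral_nonneg fun t => mul_nonneg ?_ (Real.exp_pos _).le
    rw [sub_nonneg]
    exact Real.exp_le_one_iff.mpr (by nlinarith [Real.cosh_pos t])
  have htail1 : ∫ t in Ioi T, h t ≤ x := by
    rw [← hexpT', ← integral_exp_neg_Ioi T]
    refine integral_mono (hint.mono_set (Ioi_subset_Ioi hT0.le))
      (integrableOn_exp_neg_Ioi T) fun t => ?_
    exact mul_le_of_le_one_left (Real.exp_pos _).le (by linarith [Real.exp_pos (-x * Real.cosh t)])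
  have hup : ∫ t in (0 : ℝ)..T, h t ≤ ∫ t in (0 : ℝ)..T, (x / 2 + x / 2 * Real.exp (-t)) := by
    refine intervalIntegral.integral_mono_on hT0.le (hcont.intervalIntegrable _ _)
      (Continuous.intervalIntegrable (by fun_prop) _ _) fun t ht => ?_
    have h1 : 1 - Real.exp (-x * Real.cosh t) ≤ x * Real.cosh t := by
      linarith [Real.add_one_le_exp (-x * Real.cosh t)]
    have h2 : Real.exp t * Real.exp (-t) = 1 := by rw [← Real.exp_add]; simp
    have h3 : Real.exp (-t) ≤ 1 := Real.exp_le_one_iff.mpr (by linarith [ht.1])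
    have h4 := Real.exp_pos (-t)
    calc h t ≤ x * Real.cosh t * Real.exp (-t) := mul_le_mul_of_nonneg_right h1 h4.le
      _ = x / 2 + x / 2 * (Real.exp (-t) * Real.exp (-t)) := by
          rw [Real.cosh_eq]; linear_combination (x / 2) * h2
      _ ≤ x / 2 + x / 2 * Real.exp (-t) := by
          gcongr
          exact mul_le_of_le_one_left h4.le h3
  have hlow : ∫ t in (0 : ℝ)..T, (x / 2 - x ^ 2 / 4 * Real.exp t) ≤ ∫ t in (0 : ℝ)..T, h t := by
    refine intervalIntegral.integral_mono_on hT0.le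
      (Continuous.intervalIntegrable (by fun_prop) _ _) (hcont.intervalIntegrable _ _) fun t ht => ?_
    have h2 : Real.exp t * Real.exp (-t) = 1 := by rw [← Real.exp_add]; simp
    have h4 := Real.exp_pos (-t)
    have h5 : x * Real.exp t ≤ 1 := by
      have : Real.exp t ≤ 1 / x := hexpT ▸ Real.exp_le_exp.mpr ht.2
      rwa [le_div_iff₀' hx] at this
    have h6 : 0 < x * Real.exp t := by positivity
    have h7 : Real.exp (-x * Real.cosh t) ≤ Real.exp (-(x * Real.exp t / 2)) := by
      rw [Real.exp_le_exp, Real.cosh_eq]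
      nlinarith
    have h8 := (abs_le.mp (Real.abs_exp_sub_one_sub_id_le
      (x := -(x * Real.exp t / 2)) (by rw [abs_neg, abs_of_pos] <;> linarith))).2
    calc x / 2 - x ^ 2 / 4 * Real.exp t
        = (x * Real.exp t / 2 - (x * Real.exp t / 2) ^ 2) * Real.exp (-t) := by
          linear_combination (-(x / 2) + x ^ 2 / 4 * Real.exp t) * h2
      _ ≤ h t := by
          refine mul_le_mul_of_nonneg_right ?_ h4.le
          linarith
  have hupI : ∫ t in (0 : ℝ)..T, (x / 2 + x / 2 * Real.exp (-t)) =
      x / 2 * T + x / 2 * (1 - x) := by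
    rw [intervalIntegral.integral_add (Continuous.intervalIntegrable (by fun_prop) _ _)
      (Continuous.intervalIntegrable (by fun_prop) _ _), intervalIntegral.integral_const_mul,
      intervalIntegral.integral_comp_neg (fun t => Real.exp t)]
    simp [hexpT']
    ring
  have hlowI : ∫ t in (0 : ℝ)..T, (x / 2 - x ^ 2 / 4 * Real.exp t) =
      x / 2 * T - x / 4 * (1 - x) := by
    rw [intervalIntegral.integral_sub (Continuous.intervalIntegrable (by fun_prop) _ _)
      (Continuous.intervalIntegrable (by fun_prop) _ _), intervalIntegral.integral_const_mul,
      integral_exp, hexpT]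
    simp
    field_simp
  rw [hsplit, abs_le]
  constructor <;> nlinarith

/-- `x K₁(x) = 1 - (x² / 2) log (1 / x) + O(x²)` as `x → 0⁺`, with an explicit constant. -/
theorem abs_one_sub_mul_besselK1_sub_le {x : ℝ} (hx : 0 < x) (hx1 : x < 1) :
    |1 - x * besselK1 x - x ^ 2 / 2 * Real.log (1 / x)| ≤ 3 * x ^ 2 := by
  have h1 := abs_le.mp (abs_integral_one_sub_exp_mul_exp_neg_sub_le hx hx1)
  have h2 := abs_le.mp (Real.abs_exp_sub_one_sub_id_le (x := -x)
    (by rw [abs_neg, abs_of_pos hx]; exact hx1.le))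
  rw [one_sub_mul_besselK1 hx, abs_le]
  constructor <;> nlinarith [mul_le_mul_of_nonneg_left h1.1 hx.le,
    mul_le_mul_of_nonneg_left h1.2 hx.le]

theorem isBigO_product_cdf_sub :
    (fun r : ℝ => (1 - 2 * Real.sqrt r * besselK1 (2 * Real.sqrt r)) - r * Real.log (1 / r))
      =O[𝓝[>] (0 : ℝ)] (fun r : ℝ => r) := by
  refine IsBigO.of_bound (12 + 2 * Real.log 2) ?_
  filter_upwards [Ioo_mem_nhdsGT (show (0 : ℝ) < 1 / 4 by norm_num)] with r hr
  have hs : 0 < Real.sqrt r := Real.sqrt_pos.mpr hr.1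
  have hsq : Real.sqrt r ^ 2 = r := Real.sq_sqrt hr.1.le
  have hb := abs_le.mp (abs_one_sub_mul_besselK1_sub_le (x := 2 * Real.sqrt r) (by positivity)
    (by nlinarith [hr.2]))
  have hlog : Real.log (1 / (2 * Real.sqrt r)) = Real.log (1 / r) / 2 - Real.log 2 := by
    rw [one_div, one_div, Real.log_inv, Real.log_inv, Real.log_mul (by norm_num) hs.ne',
      Real.log_sqrt hr.1.le]
    ring
  rw [hlog, mul_pow, hsq] at hb
  have h2 : 0 < r * Real.log 2 := mul_pos hr.1 (Real.log_pos (by norm_num))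
  rw [Real.norm_eq_abs, Real.norm_of_nonneg hr.1.le, abs_le]
  constructor <;> linarith [hb.1, hb.2]

theorem isLittleO_id_mul_log_one_div :
    (fun r : ℝ => r) =o[𝓝[>] (0 : ℝ)] (fun r : ℝ => r * Real.log (1 / r)) := by
  have hlog : Tendsto (fun r : ℝ => Real.log (1 / r)) (𝓝[>] 0) atTop := by
    simp only [one_div]
    exact Real.tendsto_log_atTop.comp tendsto_inv_nhdsGT_zero
  have h1 : (fun _ : ℝ => (1 : ℝ)) =o[𝓝[>] (0 : ℝ)] (fun r : ℝ => Real.log (1 / r)) :=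
    (isLittleO_const_left.mpr (.inr (tendsto_norm_atTop_atTop.comp hlog)))
  simpa using (isBigO_refl (fun r : ℝ => r) (𝓝[>] (0 : ℝ))).mul_isLittleO h1

/-- Small-argument expansion of the product-channel CDF `F(r) = 1 - 2√r·K₁(2√r)`:
`F(r) = r(1 - 2γ_E - log r) + o(r log(1/r))`, and in particular
`F(r)/(r log(1/r)) → 1` as `r → 0⁺`. -/
theorem product_cdf_asymptotic :
    (fun r : ℝ => (1 - 2 * Real.sqrt r * besselK1 (2 * Real.sqrt r)) -
        r * (1 - 2 * Real.eulerMascheroniConstant - Real.log r))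
      =o[𝓝[>] (0 : ℝ)] (fun r : ℝ => r * Real.log (1 / r)) ∧
    Tendsto (fun r : ℝ =>
        (1 - 2 * Real.sqrt r * besselK1 (2 * Real.sqrt r)) / (r * Real.log (1 / r)))
      (𝓝[>] 0) (𝓝 1) := by
  have hlo := isBigO_product_cdf_sub.trans_isLittleO isLittleO_id_mul_log_one_div
  constructor
  · refine (hlo.sub (isLittleO_id_mul_log_one_div.const_mul_left
      (1 - 2 * Real.eulerMascheroniConstant))).congr_left fun r => ?_
    rw [one_div, Real.log_inv]
    ring
  · refine (isEquivalent_iff_tendsto_one ?_).mp (show IsEquivalent _ _ _ from hlo)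
    filter_upwards [Ioo_mem_nhdsGT (show (0 : ℝ) < 1 by norm_num)] with r hr
    exact (mul_pos hr.1 (Real.log_pos ((one_lt_div hr.1).mpr hr.2))).ne'
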